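/- For every pair of constants a, b > 0 there exists a constant c > 0 such that the following holds. Let G be an n-vertex directed unweighted graph, P a set of demand pairs, and π(·,·) a consistent tiebreaking scheme for (G,P) such that every edge of G lies on some path of π(P). Let d = ⌈|E(G)|/n⌉, let S ⊆ V(G) satisfy a·d ≤ |S| ≤ b·d and deg_G(v) ≥ a·d for all v ∈ S, and let Q ⊆ P be the set of demand pairs (s,t) whose path π(s,t) contains a vertex of S. Let J be the induced-path graph of (S, π(Q)): its vertex set is S, and its edge set is the union over π ∈ π(Q) of the consecutive pairs of the sequence obtained by listing the vertices of V(π) ∩ S in the order they appear along π. Then |V(J)| = |S| and |E(J)| ≥ c·d² − |Q|. -/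

import Mathlib

open Finset

/-- A walk in a directed edge set `F`, given as the list of visited vertices. -/
def IsWalkOn {V : Type} (F : Finset (V × V)) (s t : V) (l : List V) : Prop :=
  l.Chain' (fun a b => (a, b) ∈ F) ∧ l.head? = some s ∧ l.getLast? = some t

def ReachableOn {V : Type} (F : Finset (V × V)) (s t : V) : Prop :=
  ∃ l, IsWalkOn F s t l

/-- A directed weighted graph: a finite set of directed edges together with weights. -/
structure WDigraph (V : Type) where
  Edge : Finset (V × V)
  w : V × V → ℝ

namespace WDigraph

variable {V : Type}

/-- Total weight of a walk (sum of weights of consecutive pairs). -/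
def walkWeight (G : WDigraph V) (l : List V) : ℝ :=
  ((l.zip l.tail).map G.w).sum

/-- Distance from `s` to `t` using only edges of `F`, with weights of `G`. -/
noncomputable def distOn (G : WDigraph V) (F : Finset (V × V)) (s t : V) : ℝ :=
  sInf {x | ∃ l, IsWalkOn F s t l ∧ G.walkWeight l = x}

def IsWalk (G : WDigraph V) (s t : V) (l : List V) : Prop :=
  IsWalkOn G.Edge s t l

def Reachable (G : WDigraph V) (s t : V) : Prop :=
  ReachableOn G.Edge s t

noncomputable def dist (G : WDigraph V) (s t : V) : ℝ :=
  G.distOn G.Edge s t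

/-- All edge weights equal to `1`. -/
def Unweighted (G : WDigraph V) : Prop := ∀ e ∈ G.Edge, G.w e = 1

/-- All edge weights positive. -/
def PosWeights (G : WDigraph V) : Prop := ∀ e ∈ G.Edge, 0 < G.w e

/-- `F` is (the edge set of) an exact distance preserver of `(G, P)`. -/
def IsExactPreserver (G : WDigraph V) (F : Finset (V × V)) (P : Finset (V × V)) : Prop :=
  F ⊆ G.Edge ∧ ∀ q ∈ P, ReachableOn F q.1 q.2 ∧ G.distOn F q.1 q.2 = G.dist q.1 q.2

/-- Total (in plus out) degree of a vertex. -/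
def degree [DecidableEq V] (G : WDigraph V) (v : V) : ℕ :=
  (G.Edge.filter fun e => e.1 = v ∨ e.2 = v).card

end WDigraph
/-- The list of (directed) edges of a path given by its vertex list. -/
def pathEdges {V : Type} (l : List V) : List (V × V) := l.zip l.tail

/-- A tiebreaking scheme: a fixed shortest path (a simple walk achieving the distance)
for each demand pair of `P`. -/
structure TBScheme {V : Type} (G : WDigraph V) (P : Finset (V × V)) where
  path : V × V → List V
  walk : ∀ q ∈ P, G.IsWalk q.1 q.2 (path q)
  nodup : ∀ q ∈ P, (path q).Nodup
  shortest : ∀ q ∈ P, G.walkWeight (path q) = G.dist q.1 q.2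

/-- `x` strictly precedes `y` on the list `l`. -/
def Precedes {V : Type} (l : List V) (x y : V) : Prop :=
  ∃ i j : Fin l.length, i < j ∧ l.get i = x ∧ l.get j = y

/-- The segment of `l` from (the first occurrence of) `x` to (the last occurrence of) `y`. -/
def seg {V : Type} [DecidableEq V] (l : List V) (x y : V) : List V :=
  ((l.dropWhile fun a => decide (a ≠ x)).reverse.dropWhile fun a => decide (a ≠ y)).reverse

/-- Consistency: whenever `x` precedes `y` on two paths of the scheme,
the corresponding subpaths from `x` to `y` coincide. -/
def TBScheme.Consistent {V : Type} [DecidableEq V] {G : WDigraph V} {P : Finset (V × V)}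
    (S : TBScheme G P) : Prop :=
  ∀ q₁ ∈ P, ∀ q₂ ∈ P, ∀ x y : V,
    Precedes (S.path q₁) x y → Precedes (S.path q₂) x y →
      seg (S.path q₁) x y = seg (S.path q₂) x y

/-- The paths of the scheme are pairwise edge-disjoint. -/
def TBScheme.EdgeDisjoint {V : Type} {G : WDigraph V} {P : Finset (V × V)}
    (S : TBScheme G P) : Prop :=
  ∀ q₁ ∈ P, ∀ q₂ ∈ P, S.path q₁ ≠ S.path q₂ →
    ∀ e ∈ pathEdges (S.path q₁), e ∉ pathEdges (S.path q₂)

/-- Ceiling division of naturals: `⌈a / b⌉`. -/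
def natCeilDiv (a b : ℕ) : ℕ := (a + b - 1) / b

theorem mem_pathEdges_iff {V : Type} {l : List V} {x y : V} :
    (x, y) ∈ pathEdges l ↔ ∃ A C, l = A ++ x :: y :: C := by
  unfold pathEdges
  constructor
  · intro h
    induction l with
    | nil => simp at h
    | cons u l ih =>
      cases l with
      | nil => simp at h
      | cons w l =>
        simp only [List.tail_cons, List.zip_cons_cons, List.mem_cons, Prod.mk.injEq] at h
        rcases h with ⟨rfl, rfl⟩ | h
        · exact ⟨[], l, rfl⟩
        · obtain ⟨A, C, hA⟩ := ih h
          exact ⟨u :: A, C, by rw [hA]; rfl⟩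
  · rintro ⟨A, C, rfl⟩
    induction A with
    | nil => simp
    | cons u A ih =>
      cases A with
      | nil => simp
      | cons w A =>
        simp only [List.cons_append, List.tail_cons, List.zip_cons_cons, List.mem_cons] at ih ⊢
        exact Or.inr ih

theorem exists_first_or_forall_notMem {V : Type} (T : Finset V) (l : List V) :
    (∀ v ∈ l, v ∉ T) ∨ ∃ B y C, l = B ++ y :: C ∧ y ∈ T ∧ ∀ v ∈ B, v ∉ T := by
  classical
  cases h : l.find? (fun v => decide (v ∈ T)) with
  | none => left; simpa using h
  | some y =>
    right
    rw [List.find?_eq_some_iff_append] at h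
    obtain ⟨hy, B, C, hl, hB⟩ := h
    exact ⟨B, y, C, hl, by simpa using hy, by simpa using hB⟩

theorem exists_last_or_forall_notMem {V : Type} (T : Finset V) (l : List V) :
    (∀ v ∈ l, v ∉ T) ∨ ∃ A y B, l = A ++ y :: B ∧ y ∈ T ∧ ∀ v ∈ B, v ∉ T := by
  rcases exists_first_or_forall_notMem T l.reverse with h | ⟨B, y, C, h, hy, hB⟩
  · left; simpa using h
  · right
    refine ⟨C.reverse, y, B.reverse, ?_, hy, by simpa using hB⟩
    rw [← List.reverse_reverse l, h]; simp

theorem seg_append {V : Type} [DecidableEq V] {A B C : List V} {x y : V}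
    (hl : (A ++ x :: (B ++ y :: C)).Nodup) :
    seg (A ++ x :: (B ++ y :: C)) x y = x :: (B ++ [y]) := by
  have hx : ∀ v ∈ A, decide (v ≠ x) = true := by
    intro v hv
    have := (List.nodup_append.mp hl).2.2 v hv x (by simp)
    simpa using this
  have hy : ∀ v ∈ C.reverse, decide (v ≠ y) = true := by
    intro v hv
    simp only [List.nodup_append, List.nodup_cons] at hl
    rw [List.mem_reverse] at hv
    have : v ≠ y := by
      rintro rfl
      exact hl.2.1.2.2.1.1 hv
    simpa using this
  unfold seg
  rw [List.dropWhile_append_of_pos hx, List.dropWhile_cons_of_neg (by simp)]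
  have : (x :: (B ++ y :: C)).reverse = C.reverse ++ y :: (x :: B).reverse := by simp
  rw [this, List.dropWhile_append_of_pos hy, List.dropWhile_cons_of_neg (by simp)]
  simp

theorem precedes_append {V : Type} {A B C : List V} {x y : V} :
    Precedes (A ++ x :: (B ++ y :: C)) x y := by
  refine ⟨⟨A.length, by simp⟩, ⟨A.length + (B.length + 1), by simp⟩, ?_, ?_, ?_⟩
  · simp [Fin.lt_def]
  · simp
  · simp

theorem eq_of_nodup_append_cons {V : Type} {A B A' B' : List V} {x : V}
    (hl : (A ++ x :: B).Nodup) (h : A ++ x :: B = A' ++ x :: B') : A = A' ∧ B = B' := by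
  have hA : x ∉ A := fun hx => (List.nodup_append.mp hl).2.2 x hx x (by simp) rfl
  have hA' : x ∉ A' := fun hx => (List.nodup_append.mp (h ▸ hl)).2.2 x hx x (by simp) rfl
  rw [List.append_eq_append_iff] at h
  rcases h with ⟨D, h1, h2⟩ | ⟨D, h1, h2⟩ <;> cases D <;> simp_all

theorem TBScheme.Consistent.between_eq {V : Type} [DecidableEq V] {G : WDigraph V}
    {P : Finset (V × V)} {S : TBScheme G P} (hS : S.Consistent) {q q' : V × V}
    (hq : q ∈ P) (hq' : q' ∈ P) {A B C A' B' C' : List V} {x y : V}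
    (h : S.path q = A ++ x :: (B ++ y :: C)) (h' : S.path q' = A' ++ x :: (B' ++ y :: C')) :
    B = B' := by
  have key := hS q hq q' hq' x y (h ▸ precedes_append) (h' ▸ precedes_append)
  rw [h, h', seg_append (h ▸ S.nodup q hq), seg_append (h' ▸ S.nodup q' hq')] at key
  simpa using key

/-- The edge set of the induced-path graph of `(T, π(Q))`. -/
def inducedPathEdges {V : Type} [DecidableEq V] {G : WDigraph V} {P : Finset (V × V)}
    (S : TBScheme G P) (T : Finset V) (Q : Finset (V × V)) : Finset (V × V) :=
  Q.biUnion fun q => (pathEdges ((S.path q).filter fun v => decide (v ∈ T))).toFinset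

theorem mem_inducedPathEdges_of_append {V : Type} [DecidableEq V] {G : WDigraph V}
    {P : Finset (V × V)} {S : TBScheme G P} {T : Finset V} {Q : Finset (V × V)} {q : V × V}
    (hq : q ∈ Q) {A B C : List V} {x y : V} (h : S.path q = A ++ x :: (B ++ y :: C))
    (hx : x ∈ T) (hy : y ∈ T) (hB : ∀ v ∈ B, v ∉ T) : (x, y) ∈ inducedPathEdges S T Q := by
  have hB' : B.filter (fun v => decide (v ∈ T)) = [] := by simpa using hB
  rw [inducedPathEdges, Finset.mem_biUnion]
  refine ⟨q, hq, ?_⟩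
  rw [List.mem_toFinset, mem_pathEdges_iff, h]
  refine ⟨A.filter (fun v => decide (v ∈ T)), C.filter (fun v => decide (v ∈ T)), ?_⟩
  simp [List.filter_append, hx, hy, hB']

theorem card_out_edges_le {V : Type} [DecidableEq V] {G : WDigraph V} {P : Finset (V × V)}
    {S : TBScheme G P} (hS : S.Consistent)
    (hcov : ∀ e ∈ G.Edge, ∃ q ∈ P, e ∈ pathEdges (S.path q)) (T : Finset V)
    {Q : Finset (V × V)} (hQ : ∀ q ∈ P, ∀ v ∈ S.path q, v ∈ T → q ∈ Q) :
    (G.Edge.filter fun e => e.1 ∈ T).card ≤ (inducedPathEdges S T Q).card + Q.card := by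
  rw [← Finset.card_disjSum]
  refine Finset.card_le_card_of_forall_subsingleton
    (fun e z => z.elim
      (fun p => e.1 = p.1 ∧ ∃ q ∈ P, ∃ A B C, S.path q = A ++ p.1 :: (B ++ p.2 :: C) ∧
        (B ++ [p.2]).head? = some e.2)
      (fun q => q ∈ P ∧ ∃ A C, S.path q = A ++ e.1 :: e.2 :: C ∧ e.1 ∈ T ∧
        ∀ v ∈ e.2 :: C, v ∉ T)) ?_ ?_
  · rintro ⟨x, x'⟩ he
    rw [Finset.mem_filter] at he
    obtain ⟨q, hq, hmem⟩ := hcov _ he.1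
    obtain ⟨A, C, hl⟩ := mem_pathEdges_iff.mp hmem
    have hqQ : q ∈ Q := hQ q hq x (by simp [hl]) he.2
    rcases exists_first_or_forall_notMem T (x' :: C) with h | ⟨B, y, C', h, hy, hB⟩
    · exact ⟨Sum.inr q, by simpa using hqQ, hq, A, C, hl, he.2, h⟩
    · have hl' : S.path q = A ++ x :: (B ++ y :: C') := by rw [hl, h]
      refine ⟨Sum.inl (x, y), ?_, rfl, q, hq, A, B, C', hl', ?_⟩
      · simpa using mem_inducedPathEdges_of_append hqQ hl' he.2 hy hB
      · cases B <;> simp_all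
  · rintro (⟨x, y⟩ | q) - ⟨u, u'⟩ hu ⟨w, w'⟩ hw
    · obtain ⟨-, hux, q, hq, A, B, C, hl, hh⟩ := hu
      obtain ⟨-, hwx, q', hq', A', B', C', hl', hh'⟩ := hw
      have := hS.between_eq hq hq' hl hl'
      simp_all
    · obtain ⟨-, hq, A, C, hl, huT, hC⟩ := hu
      obtain ⟨-, -, A', C', hl', hwT, hC'⟩ := hw
      have hnd := S.nodup q hq
      have last : ∀ {A C : List V} {v : V}, v ∈ T → (∀ z ∈ C, z ∉ T) →
          ((A ++ v :: C).filter fun z => decide (z ∈ T)).getLast? = some v := by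
        intro A C v hv hC
        have : C.filter (fun z => decide (z ∈ T)) = [] := by simpa using hC
        simp [List.filter_append, hv, this]
      have h1 := last (A := A) huT hC
      have h2 := last (A := A') hwT hC'
      dsimp only at hl hl' h1 h2
      rw [← hl] at h1
      rw [← hl', h1] at h2
      obtain rfl : u = w := by simpa using h2
      have := (eq_of_nodup_append_cons (hl ▸ hnd) (hl.symm.trans hl')).2
      simp_all

theorem card_in_edges_le {V : Type} [DecidableEq V] {G : WDigraph V} {P : Finset (V × V)}
    {S : TBScheme G P} (hS : S.Consistent)
    (hcov : ∀ e ∈ G.Edge, ∃ q ∈ P, e ∈ pathEdges (S.path q)) (T : Finset V)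
    {Q : Finset (V × V)} (hQ : ∀ q ∈ P, ∀ v ∈ S.path q, v ∈ T → q ∈ Q) :
    (G.Edge.filter fun e => e.2 ∈ T).card ≤ (inducedPathEdges S T Q).card + Q.card := by
  rw [← Finset.card_disjSum]
  refine Finset.card_le_card_of_forall_subsingleton
    (fun e z => z.elim
      (fun p => e.2 = p.2 ∧ ∃ q ∈ P, ∃ A B C, S.path q = A ++ p.1 :: (B ++ p.2 :: C) ∧
        (p.1 :: B).getLast? = some e.1)
      (fun q => q ∈ P ∧ ∃ A C, S.path q = (A ++ [e.1]) ++ e.2 :: C ∧ e.2 ∈ T ∧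
        ∀ v ∈ A ++ [e.1], v ∉ T)) ?_ ?_
  · rintro ⟨x', x⟩ he
    rw [Finset.mem_filter] at he
    obtain ⟨q, hq, hmem⟩ := hcov _ he.1
    obtain ⟨A, C, hl⟩ := mem_pathEdges_iff.mp hmem
    have hqQ : q ∈ Q := hQ q hq x (by simp [hl]) he.2
    rcases exists_last_or_forall_notMem T (A ++ [x']) with h | ⟨A', y, B, h, hy, hB⟩
    · exact ⟨Sum.inr q, by simpa using hqQ, hq, A, C, by simp [hl], he.2, h⟩
    · have hl' : S.path q = A' ++ y :: (B ++ x :: C) := by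
        have : S.path q = (A ++ [x']) ++ x :: C := by simp [hl]
        rw [this, h]; simp
      refine ⟨Sum.inl (y, x), ?_, rfl, q, hq, A', B, C, hl', ?_⟩
      · simpa using mem_inducedPathEdges_of_append hqQ hl' hy he.2 hB
      · have := congrArg List.getLast? h
        rw [List.getLast?_append_of_ne_nil _ (by simp)] at this
        simpa using this.symm
  · rintro (⟨x, y⟩ | q) - ⟨u', u⟩ hu ⟨w', w⟩ hw
    · obtain ⟨-, hux, q, hq, A, B, C, hl, hh⟩ := hu
      obtain ⟨-, hwx, q', hq', A', B', C', hl', hh'⟩ := hw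
      have := hS.between_eq hq hq' hl hl'
      simp_all
    · obtain ⟨-, hq, A, C, hl, huT, hA⟩ := hu
      obtain ⟨-, -, A', C', hl', hwT, hA'⟩ := hw
      have hnd := S.nodup q hq
      have first : ∀ {A C : List V} {v : V}, v ∈ T → (∀ z ∈ A, z ∉ T) →
          ((A ++ v :: C).filter fun z => decide (z ∈ T)).head? = some v := by
        intro A C v hv hA
        have : A.filter (fun z => decide (z ∈ T)) = [] := by simpa using hA
        simp only [List.filter_append, this, List.filter_cons, hv]
        simp
      have h1 := first (C := C) huT hA
      have h2 := first (C := C') hwT hA'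
      dsimp only at hl hl' h1 h2
      rw [← hl] at h1
      rw [← hl', h1] at h2
      obtain rfl : u = w := by simpa using h2
      have := (eq_of_nodup_append_cons (hl ▸ hnd) (hl.symm.trans hl')).1
      simp_all

theorem sum_degree_le {V : Type} [DecidableEq V] (G : WDigraph V) (T : Finset V) :
    ∑ v ∈ T, G.degree v ≤
      (G.Edge.filter fun e => e.1 ∈ T).card + (G.Edge.filter fun e => e.2 ∈ T).card := by
  have h1 : ∀ f : V × V → V, (G.Edge.filter fun e => f e ∈ T).card =
      ∑ v ∈ T, (G.Edge.filter fun e => f e = v).card := by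
    intro f
    rw [Finset.card_eq_sum_card_fiberwise (f := f) (t := T) (by intro e; simp)]
    refine Finset.sum_congr rfl fun v hv => ?_
    congr 1
    ext e
    simp only [Finset.mem_filter]
    grind
  rw [h1 Prod.fst, h1 Prod.snd, ← Finset.sum_add_distrib]
  refine Finset.sum_le_sum fun v _ => ?_
  rw [WDigraph.degree, Finset.filter_or]
  exact Finset.card_union_le _ _

/-- the induced-path graph `J` of `(S, π(Q))` has vertex set `S` and at
least `c·d² − |Q|` edges. -/
theorem induced_path_graph_size (a b : ℝ) (ha : 0 < a) (hb : 0 < b) :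
    ∃ c : ℝ, 0 < c ∧
      ∀ (V : Type) [DecidableEq V] [Fintype V] (G : WDigraph V), G.Unweighted →
      ∀ (P : Finset (V × V)) (S : TBScheme G P), S.Consistent →
        (∀ e ∈ G.Edge, ∃ q ∈ P, e ∈ pathEdges (S.path q)) →
        ∀ n d : ℕ, n = Fintype.card V → d = natCeilDiv G.Edge.card n →
        ∀ T : Finset V, a * (d : ℝ) ≤ (T.card : ℝ) → (T.card : ℝ) ≤ b * (d : ℝ) →
          (∀ v ∈ T, a * (d : ℝ) ≤ (G.degree v : ℝ)) →
          ∀ Q : Finset (V × V),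
            Q = P.filter (fun q => ((S.path q).toFinset ∩ T).Nonempty) →
          ∀ JV : Finset V, JV = T →
          ∀ JE : Finset (V × V),
            JE = Q.biUnion (fun q =>
              (pathEdges ((S.path q).filter fun v => decide (v ∈ T))).toFinset) →
            JV.card = T.card ∧ c * (d : ℝ) ^ 2 - (Q.card : ℝ) ≤ (JE.card : ℝ) := by
  refine ⟨a ^ 2 / 2, by positivity, ?_⟩
  intro V _ _ G _ P S hS hcov n d _ _ T hT _ hdeg Q hQ JV hJV JE hJE
  refine ⟨by rw [hJV], ?_⟩
  have hQmem : ∀ q ∈ P, ∀ v ∈ S.path q, v ∈ T → q ∈ Q := by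
    intro q hq v hv hvT
    rw [hQ, Finset.mem_filter]
    exact ⟨hq, v, by simp [hv, hvT]⟩
  have hout := card_out_edges_le hS hcov T hQmem
  have hin := card_in_edges_le hS hcov T hQmem
  have hJ : JE = inducedPathEdges S T Q := hJE
  rw [← hJ] at hout hin
  have hsum : ((∑ v ∈ T, G.degree v : ℕ) : ℝ) ≤ 2 * ((JE.card : ℝ) + Q.card) := by
    have h := sum_degree_le G T
    have : ∑ v ∈ T, G.degree v ≤ 2 * (JE.card + Q.card) := by omega
    exact_mod_cast this
  have hlow : (T.card : ℝ) * (a * d) ≤ ((∑ v ∈ T, G.degree v : ℕ) : ℝ) := by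
    rw [Nat.cast_sum, ← nsmul_eq_mul]
    exact Finset.card_nsmul_le_sum _ _ _ hdeg
  have hmul : (a * d) * (a * d) ≤ (T.card : ℝ) * (a * d) :=
    mul_le_mul_of_nonneg_right hT (by positivity)
  nlinarith
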